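/- arXiv:1906.00449 — 2 statements merged into one kernel-verified Lean document; each statement's English description precedes it below -/
import Mathlib

section
/- Let γ ∈ (0, 1/3] and let a, a' ∈ {0,1}^2 be two points at Hamming distance exactly 1. Define probability distributions Q and Q' on the four-element set {0,1}^2 by Q(a) = (1−3γ)/4 and Q(b) = (1+γ)/4 for every b ≠ a, and Q'(a') = (1−3γ)/4 and Q'(b) = (1+γ)/4 for every b ≠ a'. Then the squared Hellinger distance satisfies H²(Q, Q') = Σ_{b ∈ {0,1}^2} (√Q(b) − √Q'(b))² = 1 − γ − √(1 − 2γ − 3γ²), and moreover H²(Q, Q') ≤ 6γ². -/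
/-- Two functions that take the value `p` at one point each, the points being distinct, and the
value `q` elsewhere have squared Hellinger distance `2 (p + q) - 4 √(p q)`. -/
theorem sum_sq_sqrt_sub_sqrt_of_single_point {α : Type*} [Fintype α] {a a' : α} (hne : a ≠ a')
    {p q : ℝ} (hp : 0 ≤ p) (hq : 0 ≤ q) {Q Q' : α → ℝ}
    (hQa : Q a = p) (hQ : ∀ b ≠ a, Q b = q) (hQ'a : Q' a' = p) (hQ' : ∀ b ≠ a', Q' b = q) :
    ∑ b, (√(Q b) - √(Q' b)) ^ 2 = 2 * (p + q) - 4 * √(p * q) := by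
  rw [Fintype.sum_eq_add a a' hne fun b hb => by rw [hQ b hb.1, hQ' b hb.2, sub_self, sq, zero_mul],
    hQa, hQ'a, hQ a' hne.symm, hQ' a hne, Real.sqrt_mul hp]
  linear_combination 2 * Real.sq_sqrt hp + 2 * Real.sq_sqrt hq


/-- For `γ ∈ (0, 1/3]` and `a, a' ∈ {0,1}²` at Hamming distance
exactly 1, the distributions `Q, Q'` on `{0,1}²` given by mass `(1−3γ)/4` at `a`
(resp. `a'`) and `(1+γ)/4` elsewhere satisfy
`H²(Q,Q') = 1 − γ − √(1 − 2γ − 3γ²) ≤ 6γ²`. -/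
theorem hellinger_distance_hypercube
    (γ : ℝ) (hγ0 : 0 < γ) (hγ : γ ≤ 1 / 3)
    (a a' : Bool × Bool)
    (hdist : ((if a.1 ≠ a'.1 then 1 else 0) + (if a.2 ≠ a'.2 then 1 else 0) : ℕ) = 1)
    (Q Q' : Bool × Bool → ℝ)
    (hQa : Q a = (1 - 3 * γ) / 4) (hQ : ∀ b ≠ a, Q b = (1 + γ) / 4)
    (hQ'a : Q' a' = (1 - 3 * γ) / 4) (hQ' : ∀ b ≠ a', Q' b = (1 + γ) / 4) :
    (∑ b : Bool × Bool, (Real.sqrt (Q b) - Real.sqrt (Q' b)) ^ 2)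
        = 1 - γ - Real.sqrt (1 - 2 * γ - 3 * γ ^ 2) ∧
    (∑ b : Bool × Bool, (Real.sqrt (Q b) - Real.sqrt (Q' b)) ^ 2) ≤ 6 * γ ^ 2 := by
  have hne : a ≠ a' := by
    rintro rfl
    simp at hdist
  have hsum : ∑ b, (√(Q b) - √(Q' b)) ^ 2 = 1 - γ - √(1 - 2 * γ - 3 * γ ^ 2) := by
    rw [sum_sq_sqrt_sub_sqrt_of_single_point hne (by linarith) (by linarith) hQa hQ hQ'a hQ',
      show 1 - 2 * γ - 3 * γ ^ 2 = 4 ^ 2 * ((1 - 3 * γ) / 4 * ((1 + γ) / 4)) by ring,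
      Real.sqrt_mul (sq_nonneg 4), Real.sqrt_sq zero_le_four]
    ring
  refine ⟨hsum, hsum.trans_le ?_⟩
  have hle : 1 - γ - 6 * γ ^ 2 ≤ √(1 - 2 * γ - 3 * γ ^ 2) := by
    apply Real.le_sqrt_of_sq_le
    have h : 0 ≤ (1 - 3 * γ) * (8 * γ ^ 2 + 12 * γ ^ 3) :=
      mul_nonneg (by linarith) (by positivity)
    linarith
  linarith
end

section
/- Minimax lower bound for pairwise {0,1}²-valued prediction: Let X be a measurable space and let 𝓖 be a class of measurable functions g : X → {0,1}^2 with {0,1}²-dimension d ≥ 2. Let 𝒫 be the family of probability distributions P over X × {0,1}^2 for which at least one g ∈ 𝓖 achieves the Bayes-Hamming loss of P. Then for every γ ∈ (0, 1/3] and every m ≥ d: inf_A sup_{P∈𝒫} E_{S∼P^m}[ R_P(A(S)) − min_{g∈𝓖} R_P(g) ] ≥ (1/81) · min( (d−1)/(γ m), √((d−1)/m) ), where the infimum is over all maps A : (X×{0,1}^2)^m → 𝓖 (learning algorithms), S is an i.i.d. sample of size m from P, and R_P(g) = E_{(x,y)∼P}[L_H(g(x), y)] with Hamming loss L_H(y,y')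 = 1[y_1 ≠ y'_1] + 1[y_2 ≠ y'_2]. -/
open MeasureTheory

/-- A class `G` of functions `X → {0,1}²` shatters a finite set `S` (in the
`{0,1}²` sense) if every `{0,1}²`-valued pattern on `S` is realized by some
`g ∈ G`. -/
def PairShatters {X : Type*} (G : Set (X → Bool × Bool)) (S : Finset X) : Prop :=
  ∀ c : X → Bool × Bool, ∃ g ∈ G, ∀ x ∈ S, g x = c x

/-- The `{0,1}²`-dimension of a class `G` of functions `X → {0,1}²`: the supremum
(in `ℕ∞`) of cardinalities of `{0,1}²`-shattered finite sets. -/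
noncomputable def pairDim {X : Type*} (G : Set (X → Bool × Bool)) : ℕ∞ :=
  sSup ((fun S : Finset X => (S.card : ℕ∞)) '' {S : Finset X | PairShatters G S})

/-- Expected Hamming risk of a predictor `g : X → {0,1}²` under a distribution
`P` on `X × {0,1}²`, with Hamming loss `1[y₁ ≠ y₁'] + 1[y₂ ≠ y₂']`. -/
noncomputable def hammingRisk2 {X : Type*} [MeasurableSpace X]
    (P : Measure (X × (Bool × Bool))) (g : X → Bool × Bool) : ℝ :=
  ∫ p, ((if (g p.1).1 ≠ p.2.1 then (1 : ℝ) else 0)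
      + (if (g p.1).2 ≠ p.2.2 then (1 : ℝ) else 0)) ∂P

noncomputable section
namespace PairwiseMinimax

/-- The Hamming loss on `{0,1}²`. -/
def hammingLoss (a y : Bool × Bool) : ℝ :=
  (if a.1 ≠ y.1 then 1 else 0) + (if a.2 ≠ y.2 then 1 else 0)

/-- The probability of observing the bit `b` when the favoured bit is `a` and the bias is `h`. -/
def bitWeight (h : ℝ) (a b : Bool) : ℝ := if a = b then (1 + h) / 2 else (1 - h) / 2

/-- The conditional probability of the label `y` when the favoured label is `a`. -/
def labelWeight (h : ℝ) (a y : Bool × Bool) : ℝ := bitWeight h a.1 y.1 * bitWeight h a.2 y.2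

/-- The joint law of a uniform index and a noisy version of its label under `c`. -/
def sampleWeight (d : ℕ) (h : ℝ) (c : Fin d → Bool × Bool) (o : Fin d × (Bool × Bool)) : ℝ :=
  labelWeight h (c o.1) o.2 / d

theorem hammingLoss_nonneg (a y : Bool × Bool) : 0 ≤ hammingLoss a y := by
  unfold hammingLoss; positivity

theorem bitWeight_nonneg {h : ℝ} (h0 : 0 ≤ h) (h1 : h ≤ 1) (a b : Bool) :
    0 ≤ bitWeight h a b := by
  unfold bitWeight; split_ifs <;> linarith

theorem labelWeight_nonneg {h : ℝ} (h0 : 0 ≤ h) (h1 : h ≤ 1) (a y : Bool × Bool) :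
    0 ≤ labelWeight h a y :=
  mul_nonneg (bitWeight_nonneg h0 h1 _ _) (bitWeight_nonneg h0 h1 _ _)

theorem sampleWeight_nonneg {d : ℕ} {h : ℝ} (h0 : 0 ≤ h) (h1 : h ≤ 1)
    (c : Fin d → Bool × Bool) (o : Fin d × (Bool × Bool)) : 0 ≤ sampleWeight d h c o :=
  div_nonneg (labelWeight_nonneg h0 h1 _ _) (Nat.cast_nonneg d)

theorem sum_labelWeight (h : ℝ) (a : Bool × Bool) : ∑ y, labelWeight h a y = 1 := by
  obtain ⟨_ | _, _ | _⟩ := a <;>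
    simp [Fintype.sum_prod_type, labelWeight, bitWeight] <;> ring

theorem sum_sampleWeight {d : ℕ} (hd : d ≠ 0) (h : ℝ) (c : Fin d → Bool × Bool) :
    ∑ o, sampleWeight d h c o = 1 := by
  have : (d : ℝ) ≠ 0 := Nat.cast_ne_zero.mpr hd
  rw [Fintype.sum_prod_type]
  simp only [sampleWeight, ← Finset.sum_div, sum_labelWeight]
  simp [this]

theorem sum_labelWeight_mul_hammingLoss (h : ℝ) (a b : Bool × Bool) :
    ∑ y, labelWeight h a y * hammingLoss b y = (1 - h) + h * hammingLoss b a := by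
  obtain ⟨_ | _, _ | _⟩ := a <;> obtain ⟨_ | _, _ | _⟩ := b <;>
    simp [Fintype.sum_prod_type, labelWeight, bitWeight, hammingLoss] <;> ring

/-- The risk of a predictor under `sampleWeight`, in terms of its Hamming distance from `c`. -/
theorem sum_sampleWeight_mul_hammingLoss {d : ℕ} (hd : d ≠ 0) (h : ℝ)
    (c b : Fin d → Bool × Bool) :
    ∑ o, sampleWeight d h c o * hammingLoss (b o.1) o.2
      = (1 - h) + h / d * ∑ i, hammingLoss (b i) (c i) := by
  have hd' : (d : ℝ) ≠ 0 := Nat.cast_ne_zero.mpr hd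
  have key : ∀ i, ∑ y, sampleWeight d h c (i, y) * hammingLoss (b i) y
      = (1 - h) / d + h / d * hammingLoss (b i) (c i) := by
    intro i
    have := sum_labelWeight_mul_hammingLoss h (c i) (b i)
    calc _ = (∑ y, labelWeight h (c i) y * hammingLoss (b i) y) / d := by
          rw [Finset.sum_div]
          exact Finset.sum_congr rfl fun y _ => by simp only [sampleWeight]; ring
      _ = _ := by rw [this]; ring
  rw [Fintype.sum_prod_type]
  simp only [key, Finset.sum_add_distrib, ← Finset.mul_sum]
  simp
  field_simp

/-- A lower bound on the overlap of two product distributions through a lower bound `s`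
for the geometric mean of their factors. -/
theorem one_sub_le_two_mul_sum_min_prod {α : Type*} [Fintype α] (m : ℕ) {p q s : α → ℝ} {ε : ℝ}
    (hp : ∀ a, 0 ≤ p a) (hq : ∀ a, 0 ≤ q a)
    (hp1 : ∑ a, p a = 1) (hq1 : ∑ a, q a = 1) (hsq : ∀ a, s a ^ 2 ≤ p a * q a)
    (hε : ε ≤ 1) (hsum : 1 - ε ≤ ∑ a, s a) :
    1 - 2 * m * ε ≤ 2 * ∑ w : Fin m → α, min (∏ t, p (w t)) (∏ t, q (w t)) := by
  have hprod : ∀ r : α → ℝ, ∑ w : Fin m → α, ∏ t, r (w t) = (∑ a, r a) ^ m := by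
    intro r
    have := Finset.sum_pow' Finset.univ r m
    simpa using this.symm
  have cs := Finset.sum_sq_le_sum_mul_sum_of_sq_le_mul (Finset.univ : Finset (Fin m → α))
    (r := fun w => ∏ t, s (w t)) (f := fun w => min (∏ t, p (w t)) (∏ t, q (w t)))
    (g := fun w => max (∏ t, p (w t)) (∏ t, q (w t)))
    (fun w _ => le_min (Finset.prod_nonneg fun _ _ => hp _) (Finset.prod_nonneg fun _ _ => hq _))
    (fun w _ => le_max_of_le_left (Finset.prod_nonneg fun _ _ => hp _))
    (fun w _ => by
      rw [min_mul_max, ← Finset.prod_pow, ← Finset.prod_mul_distrib]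
      exact Finset.prod_le_prod (fun _ _ => sq_nonneg _) fun _ _ => hsq _)
  have hmax : ∑ w : Fin m → α, max (∏ t, p (w t)) (∏ t, q (w t)) ≤ 2 := by
    calc _ ≤ ∑ w : Fin m → α, (∏ t, p (w t) + ∏ t, q (w t)) :=
          Finset.sum_le_sum fun w _ => max_le_add_of_nonneg
            (Finset.prod_nonneg fun _ _ => hp _) (Finset.prod_nonneg fun _ _ => hq _)
      _ = 2 := by rw [Finset.sum_add_distrib, hprod, hprod, hp1, hq1]; norm_num
  have hmin : 0 ≤ ∑ w : Fin m → α, min (∏ t, p (w t)) (∏ t, q (w t)) :=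
    Finset.sum_nonneg fun w _ =>
      le_min (Finset.prod_nonneg fun _ _ => hp _) (Finset.prod_nonneg fun _ _ => hq _)
  have bern := one_add_mul_le_pow (a := -ε) (by linarith) (m * 2)
  have hpow : (1 + -ε) ^ (m * 2) ≤ ((∑ a, s a) ^ m) ^ 2 := by
    rw [← pow_mul]
    exact pow_le_pow_left₀ (by linarith) (by linarith) _
  rw [hprod] at cs
  push_cast at bern
  nlinarith [mul_le_mul_of_nonneg_left hmax hmin]

/-- The two-point method: averaging over a family of distributions permuted by an involution
`σ` for which every outcome is an error for `c` or for `σ c`. -/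
theorem card_mul_le_two_mul_sum_error {C Ω : Type*} [Fintype C] [Fintype Ω] {σ : C → C}
    (hσ : Function.Involutive σ) {p err : C → Ω → ℝ} {δ : ℝ} (hp : ∀ c w, 0 ≤ p c w)
    (herr0 : ∀ c w, 0 ≤ err c w) (herr : ∀ c w, 1 ≤ err c w + err (σ c) w)
    (hmin : ∀ c, δ ≤ ∑ w, min (p c w) (p (σ c) w)) :
    Fintype.card C * δ ≤ 2 * ∑ c, ∑ w, p c w * err c w := by
  have hsymm : ∑ c, ∑ w, p (σ c) w * err (σ c) w = ∑ c, ∑ w, p c w * err c w :=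
    Equiv.sum_comp hσ.toPerm fun c => ∑ w, p c w * err c w
  calc Fintype.card C * δ = ∑ _c : C, δ := by simp
    _ ≤ ∑ c, (∑ w, p c w * err c w + ∑ w, p (σ c) w * err (σ c) w) := by
        refine Finset.sum_le_sum fun c _ => (hmin c).trans ?_
        rw [← Finset.sum_add_distrib]
        refine Finset.sum_le_sum fun w _ => ?_
        have h0 : 0 ≤ min (p c w) (p (σ c) w) := le_min (hp _ _) (hp _ _)
        have h1 := mul_le_mul_of_nonneg_right (min_le_left (p c w) (p (σ c) w)) (herr0 c w)
        have h2 := mul_le_mul_of_nonneg_right (min_le_right (p c w) (p (σ c) w)) (herr0 (σ c) w)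
        nlinarith [mul_le_mul_of_nonneg_left (herr c w) h0]
    _ = _ := by rw [Finset.sum_add_distrib, hsymm]; ring

/-- The overlap of the `m`-sample laws of two labellings that differ at a single index, where
the conditional laws of the label are close. -/
theorem one_sub_le_two_mul_sum_min_sampleWeight {d : ℕ} (hd : d ≠ 0) (m : ℕ) {h : ℝ} (h0 : 0 ≤ h)
    (h1 : h ≤ 1) (c : Fin d → Bool × Bool) (i : Fin d) (b : Bool × Bool)
    (hb : ∀ y, (1 - h ^ 2) * ((labelWeight h (c i) y + labelWeight h b y) / 2) ^ 2
      ≤ labelWeight h (c i) y * labelWeight h b y) :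
    1 - 2 * m * (h ^ 2 / d) ≤ 2 * ∑ w : Fin m → Fin d × (Bool × Bool),
      min (∏ t, sampleWeight d h c (w t)) (∏ t, sampleWeight d h (Function.update c i b) (w t)) := by
  have hd' : (1 : ℝ) ≤ d := Nat.one_le_cast.mpr (Nat.one_le_iff_ne_zero.mpr hd)
  have hh : 0 ≤ 1 - h ^ 2 := by nlinarith
  set c' := Function.update c i b with hc'
  refine one_sub_le_two_mul_sum_min_prod m
    (s := fun o => (if o.1 = i then 1 - h ^ 2 else 1) *
      ((sampleWeight d h c o + sampleWeight d h c' o) / 2))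
    (sampleWeight_nonneg h0 h1 c) (sampleWeight_nonneg h0 h1 c')
    (sum_sampleWeight hd h c) (sum_sampleWeight hd h c') ?_ ?_ ?_
  · rintro ⟨j, y⟩
    by_cases hj : j = i
    · subst hj
      simp only [if_true, sampleWeight, hc', Function.update_self]
      have := mul_le_mul_of_nonneg_left (hb y) hh
      have hle : (1 - h ^ 2) * (labelWeight h (c j) y * labelWeight h b y)
          ≤ labelWeight h (c j) y * labelWeight h b y :=
        mul_le_of_le_one_left
          (mul_nonneg (labelWeight_nonneg h0 h1 _ _) (labelWeight_nonneg h0 h1 _ _))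
          (by nlinarith)
      have key := div_le_div_of_nonneg_right (this.trans hle) (sq_nonneg (d : ℝ))
      calc _ = _ := by ring
        _ ≤ _ := key
        _ = _ := by ring
    · simp only [hj, if_false, sampleWeight, hc', Function.update_of_ne hj]
      exact le_of_eq (by ring)
  · rw [div_le_one (by linarith)]; nlinarith
  · have hsplit : ∀ o : Fin d × (Bool × Bool), (if o.1 = i then 1 - h ^ 2 else 1) *
        ((sampleWeight d h c o + sampleWeight d h c' o) / 2)
        = (sampleWeight d h c o + sampleWeight d h c' o) / 2
          - if o.1 = i then h ^ 2 * ((sampleWeight d h c o + sampleWeight d h c' o) / 2) else 0 := by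
      intro o; split_ifs <;> ring
    have hfib : ∀ c : Fin d → Bool × Bool, ∑ y, sampleWeight d h c (i, y) = 1 / d := fun c => by
      simp only [sampleWeight, ← Finset.sum_div, sum_labelWeight]
    refine le_of_eq ?_
    simp only [hsplit, Finset.sum_sub_distrib, ← Finset.sum_div, Finset.sum_add_distrib,
      sum_sampleWeight hd]
    rw [Fintype.sum_prod_type, Finset.sum_eq_single i]
    · simp only [if_true, ← Finset.mul_sum, ← Finset.sum_div, Finset.sum_add_distrib, hfib]
      ring
    · intro j _ hj; simp [hj]
    · simp

/-- From `m` samples, a coordinate of the label at the index `i` is hard to learn: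
`π` is the coordinate and `flip` the transformation of `{0,1}²` flipping it. -/
theorem card_le_eight_mul_sum_coordinate_error {d : ℕ} (hd : d ≠ 0) {m : ℕ} {h : ℝ} (h0 : 0 ≤ h)
    (h1 : h ≤ 1) (hm : 4 * m * h ^ 2 ≤ d) (i : Fin d) {π : Bool × Bool → Bool}
    {flip : Bool × Bool → Bool × Bool} (hflip : Function.Involutive flip)
    (hπ : ∀ b, π (flip b) = !π b)
    (hclose : ∀ b y, (1 - h ^ 2) * ((labelWeight h b y + labelWeight h (flip b) y) / 2) ^ 2
      ≤ labelWeight h b y * labelWeight h (flip b) y)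
    (a : (Fin m → Fin d × (Bool × Bool)) → Fin d → Bool × Bool) :
    (Fintype.card (Fin d → Bool × Bool) : ℝ) ≤ 8 * ∑ c : Fin d → Bool × Bool,
      ∑ w : Fin m → Fin d × (Bool × Bool),
        (∏ t, sampleWeight d h c (w t)) * (if π (a w i) ≠ π (c i) then 1 else 0) := by
  have hd' : (0 : ℝ) < d := Nat.cast_pos.mpr (Nat.pos_of_ne_zero hd)
  have key := card_mul_le_two_mul_sum_error (C := Fin d → Bool × Bool)
    (Ω := Fin m → Fin d × (Bool × Bool)) (σ := fun c => Function.update c i (flip (c i)))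
    (p := fun c w => ∏ t, sampleWeight d h c (w t))
    (err := fun c w => if π (a w i) ≠ π (c i) then 1 else 0) (δ := 1 / 4)
    (fun c => by simp [hflip (c i)])
    (fun c w => Finset.prod_nonneg fun _ _ => sampleWeight_nonneg h0 h1 _ _)
    (fun c w => by positivity)
    (fun c w => by
      simp only [Function.update_self, hπ]
      cases π (a w i) <;> cases π (c i) <;> simp)
    (fun c => by
      have hov := one_sub_le_two_mul_sum_min_sampleWeight hd m h0 h1 c i (flip (c i))
        (hclose (c i))
      have : 2 * m * (h ^ 2 / d) ≤ 1 / 2 := by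
        rw [← mul_div_assoc, div_le_iff₀ hd']; linarith
      linarith)
  linarith

theorem bitWeight_not (h : ℝ) (a y : Bool) :
    (1 - h ^ 2) * ((bitWeight h a y + bitWeight h (!a) y) / 2) ^ 2
      = bitWeight h a y * bitWeight h (!a) y := by
  cases a <;> cases y <;> simp [bitWeight] <;> ring

theorem labelWeight_flip_fst (h : ℝ) (b y : Bool × Bool) :
    (1 - h ^ 2) * ((labelWeight h b y + labelWeight h (!b.1, b.2) y) / 2) ^ 2
      = labelWeight h b y * labelWeight h (!b.1, b.2) y := by
  unfold labelWeight
  linear_combination (bitWeight h b.2 y.2) ^ 2 * bitWeight_not h b.1 y.1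

theorem labelWeight_flip_snd (h : ℝ) (b y : Bool × Bool) :
    (1 - h ^ 2) * ((labelWeight h b y + labelWeight h (b.1, !b.2) y) / 2) ^ 2
      = labelWeight h b y * labelWeight h (b.1, !b.2) y := by
  unfold labelWeight
  linear_combination (bitWeight h b.1 y.1) ^ 2 * bitWeight_not h b.2 y.2

/-- For every estimator of the labelling there is a labelling for which its expected Hamming
distance from the truth, after `m` samples, is at least `d / 4`. -/
theorem exists_labelling_le_expected_distance {d : ℕ} (hd : d ≠ 0) {m : ℕ} {h : ℝ} (h0 : 0 ≤ h)
    (h1 : h ≤ 1) (hm : 4 * m * h ^ 2 ≤ d)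
    (a : (Fin m → Fin d × (Bool × Bool)) → Fin d → Bool × Bool) :
    ∃ c : Fin d → Bool × Bool, (d : ℝ) / 4 ≤ ∑ w : Fin m → Fin d × (Bool × Bool),
      (∏ t, sampleWeight d h c (w t)) * ∑ i, hammingLoss (a w i) (c i) := by
  obtain ⟨c, -, hc⟩ := Finset.exists_le_of_sum_le (s := Finset.univ)
    (f := fun _ : Fin d → Bool × Bool => (d : ℝ) / 4)
    (g := fun c => ∑ w : Fin m → Fin d × (Bool × Bool),
      (∏ t, sampleWeight d h c (w t)) * ∑ i, hammingLoss (a w i) (c i))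
    Finset.univ_nonempty (by
      have hi : ∀ i : Fin d, (Fintype.card (Fin d → Bool × Bool) : ℝ) / 4
          ≤ ∑ c : Fin d → Bool × Bool, ∑ w : Fin m → Fin d × (Bool × Bool),
            (∏ t, sampleWeight d h c (w t)) * hammingLoss (a w i) (c i) := by
        intro i
        have e₁ := card_le_eight_mul_sum_coordinate_error hd h0 h1 hm i (π := Prod.fst)
          (flip := fun b => (!b.1, b.2)) (fun b => by simp) (fun b => rfl)
          (fun b y => (labelWeight_flip_fst h b y).le) a
        have e₂ := card_le_eight_mul_sum_coordinate_error hd h0 h1 hm i (π := Prod.snd)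
          (flip := fun b => (b.1, !b.2)) (fun b => by simp) (fun b => rfl)
          (fun b y => (labelWeight_flip_snd h b y).le) a
        simp only [hammingLoss, mul_add, Finset.sum_add_distrib]
        linarith
      calc _ = ∑ _i : Fin d, (Fintype.card (Fin d → Bool × Bool) : ℝ) / 4 := by
            simp only [Finset.sum_const, nsmul_eq_mul, Finset.card_univ, Fintype.card_fin]; ring
        _ ≤ _ := Finset.sum_le_sum fun i _ => hi i
        _ = _ := by
            rw [Finset.sum_comm]
            refine Finset.sum_congr rfl fun c _ => ?_
            rw [Finset.sum_comm]
            simp only [Finset.mul_sum])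
  exact ⟨c, hc⟩

/-- The distribution on a finite type with the given weights. -/
def weightPMF {α : Type*} [Fintype α] (q : α → ℝ) (hq : ∀ a, 0 ≤ q a) (hq1 : ∑ a, q a = 1) :
    PMF α :=
  PMF.ofFintype (fun a => ENNReal.ofReal (q a)) (by
    rw [← ENNReal.ofReal_sum_of_nonneg fun a _ => hq a, hq1, ENNReal.ofReal_one])

theorem weightPMF_toReal {α : Type*} [Fintype α] {q : α → ℝ} (hq : ∀ a, 0 ≤ q a)
    (hq1 : ∑ a, q a = 1) (a : α) : (weightPMF q hq hq1 a).toReal = q a := by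
  simp [weightPMF, hq a]

/-- Expectation over an i.i.d. sample from the image of a finite distribution. -/
theorem integral_pi_map_weightPMF {α β : Type*} [Fintype α] [MeasurableSpace α]
    [MeasurableSingletonClass α] [MeasurableSpace β] {q : α → ℝ} (hq : ∀ a, 0 ≤ q a)
    (hq1 : ∑ a, q a = 1) {φ : α → β} (hφ : Measurable φ) {m : ℕ} {F : (Fin m → β) → ℝ}
    (hF : Measurable F) :
    ∫ S, F S ∂(Measure.pi fun _ : Fin m => (weightPMF q hq hq1).toMeasure.map φ)
      = ∑ w : Fin m → α, (∏ t, q (w t)) * F (fun t => φ (w t)) := by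
  have : IsProbabilityMeasure ((weightPMF q hq hq1).toMeasure.map φ) :=
    Measure.isProbabilityMeasure_map hφ.aemeasurable
  rw [← Measure.pi_map_pi fun _ => hφ.aemeasurable,
    integral_map (measurable_of_finite _).aemeasurable hF.aestronglyMeasurable,
    integral_fintype .of_finite]
  refine Finset.sum_congr rfl fun w _ => ?_
  rw [measureReal_def, Measure.pi_singleton, ENNReal.toReal_prod, smul_eq_mul]
  congr 1
  refine Finset.prod_congr rfl fun t _ => ?_
  rw [PMF.toMeasure_apply_singleton _ _ (measurableSet_singleton _), weightPMF_toReal]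

theorem hammingRisk2_map_weightPMF {α X : Type*} [Fintype α] [MeasurableSpace α]
    [MeasurableSingletonClass α] [MeasurableSpace X] {q : α → ℝ} (hq : ∀ a, 0 ≤ q a)
    (hq1 : ∑ a, q a = 1) {φ : α → X × (Bool × Bool)} (hφ : Measurable φ) {g : X → Bool × Bool}
    (hg : Measurable g) :
    hammingRisk2 ((weightPMF q hq hq1).toMeasure.map φ) g
      = ∑ a, q a * hammingLoss (g (φ a).1) (φ a).2 := by
  have hmeas : Measurable fun p : X × (Bool × Bool) => hammingLoss (g p.1) p.2 :=
    (measurable_of_finite fun z : (Bool × Bool) × (Bool × Bool) => hammingLoss z.1 z.2).comp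
      ((hg.comp measurable_fst).prodMk measurable_snd)
  change ∫ p : X × (Bool × Bool), hammingLoss (g p.1) p.2 ∂_ = _
  rw [integral_map hφ.aemeasurable hmeas.aestronglyMeasurable, PMF.integral_eq_sum]
  simp only [weightPMF_toReal, smul_eq_mul]

/-- A class of dimension `d` realizes all labellings of some `d` points. -/
theorem exists_points_of_pairDim_eq {X : Type*} {𝒢 : Set (X → Bool × Bool)} {d : ℕ} (hd : d ≠ 0)
    (hdim : pairDim 𝒢 = (d : ℕ∞)) :
    ∃ x : Fin d → X, ∀ c : Fin d → Bool × Bool, ∃ g ∈ 𝒢, ∀ i, g (x i) = c i := by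
  obtain ⟨_, ⟨S, hS, rfl⟩, hlt⟩ := lt_sSup_iff.mp
    (show ((d - 1 : ℕ) : ℕ∞) < pairDim 𝒢 by rw [hdim]; exact_mod_cast Nat.pred_lt hd)
  have hcard : d ≤ S.card := by
    have : d - 1 < S.card := Nat.cast_lt.mp hlt
    omega
  have hinj : Function.Injective fun i : Fin d => (S.equivFin.symm (Fin.castLE hcard i) : X) :=
    Subtype.val_injective.comp (S.equivFin.symm.injective.comp (Fin.castLE_injective hcard))
  refine ⟨fun i => (S.equivFin.symm (Fin.castLE hcard i) : X), fun c => ?_⟩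
  obtain ⟨g, hg, hgS⟩ := hS (Function.extend _ c fun _ => (false, false))
  exact ⟨g, hg, fun i => (hgS _ (Subtype.coe_prop _)).trans (hinj.extend_apply _ _ i)⟩

end PairwiseMinimax
end

open PairwiseMinimax in
/-- Minimax lower bound for pairwise `{0,1}²`-valued prediction.
If `𝒢` has `{0,1}²`-dimension `d ≥ 2`, and `Pfam` is the family of distributions
over `X × {0,1}²` whose Bayes-Hamming loss is achieved by some `g ∈ 𝒢`, then
for every `γ ∈ (0, 1/3]`, every `m ≥ d`, and every learning algorithm
`A : (X × {0,1}²)^m → 𝒢`, there is a distribution `P ∈ Pfam` whose expected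
excess risk over `m` i.i.d. samples is at least
`(1/81) · min( (d−1)/(γm), √((d−1)/m) )`. -/
theorem minimax_lower_bound_pairwise
    {X : Type*} [MeasurableSpace X]
    (𝒢 : Set (X → Bool × Bool)) (h𝒢meas : ∀ g ∈ 𝒢, Measurable g)
    (d : ℕ) (hd : 2 ≤ d) (hdim : pairDim 𝒢 = (d : ℕ∞))
    (Pfam : Set (Measure (X × (Bool × Bool))))
    (hPfam : ∀ P, P ∈ Pfam ↔ (IsProbabilityMeasure P ∧ ∃ g ∈ 𝒢,
      ∀ h : X → Bool × Bool, Measurable h → hammingRisk2 P g ≤ hammingRisk2 P h))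
    (γ : ℝ) (hγ0 : 0 < γ) (hγ : γ ≤ 1 / 3)
    (m : ℕ) (hm : d ≤ m)
    (A : (Fin m → X × (Bool × Bool)) → X → Bool × Bool)
    (hA : ∀ S, A S ∈ 𝒢)
    (hA_meas : ∀ P ∈ Pfam,
      Measurable (fun S : Fin m → X × (Bool × Bool) => hammingRisk2 P (A S))) :
    ∃ (P : Measure (X × (Bool × Bool))) (_ : IsProbabilityMeasure P), P ∈ Pfam ∧
      (1 / 81 : ℝ) * min (((d : ℝ) - 1) / (γ * m)) (Real.sqrt (((d : ℝ) - 1) / m))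
        ≤ ∫ S, (hammingRisk2 P (A S)
              - sInf {r : ℝ | ∃ g ∈ 𝒢, r = hammingRisk2 P g})
            ∂(Measure.pi fun _ : Fin m => P) := by
  have hd0 : d ≠ 0 := by omega
  have hdR : (2 : ℝ) ≤ d := by exact_mod_cast hd
  have hmd : (d : ℝ) ≤ m := by exact_mod_cast hm
  have hmR : (0 : ℝ) < m := by linarith
  obtain ⟨x, hx⟩ := exists_points_of_pairDim_eq hd0 hdim
  obtain ⟨h, hh⟩ : ∃ h : ℝ, h = √((d : ℝ) / m) / 2 := ⟨_, rfl⟩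
  have hsq : h ^ 2 = (d : ℝ) / m / 4 := by
    rw [hh, div_pow, Real.sq_sqrt (by positivity)]; norm_num
  have h0 : 0 ≤ h := by rw [hh]; positivity
  have h1 : h ≤ 1 := by
    have : √((d : ℝ) / m) ≤ 1 := Real.sqrt_le_one.mpr ((div_le_one hmR).mpr hmd)
    linarith
  have hhm : 4 * m * h ^ 2 ≤ d := by rw [hsq]; exact le_of_eq (by field_simp)
  obtain ⟨φ, hφ⟩ : ∃ φ : Fin d × (Bool × Bool) → X × (Bool × Bool), φ = fun o => (x o.1, o.2) :=
    ⟨_, rfl⟩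
  have hφm : Measurable φ := measurable_of_finite φ
  obtain ⟨c, hc⟩ := exists_labelling_le_expected_distance hd0 h0 h1 hhm
    fun w i => A (fun t => φ (w t)) (x i)
  have hq := sampleWeight_nonneg h0 h1 c
  have hq1 := sum_sampleWeight hd0 h c
  obtain ⟨P, hP⟩ : ∃ P, P = (weightPMF _ hq hq1).toMeasure.map φ := ⟨_, rfl⟩
  have hprob : IsProbabilityMeasure P := by
    rw [hP]; exact Measure.isProbabilityMeasure_map hφm.aemeasurable
  have hrisk : ∀ g : X → Bool × Bool, Measurable g →
      hammingRisk2 P g = (1 - h) + h / d * ∑ i, hammingLoss (g (x i)) (c i) := by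
    intro g hg
    rw [hP, hammingRisk2_map_weightPMF hq hq1 hφm hg,
      ← sum_sampleWeight_mul_hammingLoss hd0 h c fun i => g (x i), hφ]
  have hbayes : ∀ g : X → Bool × Bool, Measurable g → 1 - h ≤ hammingRisk2 P g := by
    intro g hg
    rw [hrisk g hg]
    have : 0 ≤ ∑ i, hammingLoss (g (x i)) (c i) :=
      Finset.sum_nonneg fun i _ => hammingLoss_nonneg _ _
    have : 0 ≤ h / d * ∑ i, hammingLoss (g (x i)) (c i) := by positivity
    linarith
  obtain ⟨g₀, hg₀, hg₀c⟩ := hx c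
  have hopt : hammingRisk2 P g₀ = 1 - h := by
    rw [hrisk g₀ (h𝒢meas g₀ hg₀)]
    simp [hg₀c, hammingLoss]
  have hmem : P ∈ Pfam :=
    (hPfam P).mpr ⟨hprob, g₀, hg₀, fun g hg => hopt ▸ hbayes g hg⟩
  have hinf : sInf {r : ℝ | ∃ g ∈ 𝒢, r = hammingRisk2 P g} = 1 - h :=
    IsLeast.csInf_eq ⟨⟨g₀, hg₀, hopt.symm⟩, by
      rintro _ ⟨g, hg, rfl⟩
      exact hbayes g (h𝒢meas g hg)⟩
  refine ⟨P, hprob, hmem, ?_⟩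
  have hint : ∫ S, (hammingRisk2 P (A S) - sInf {r : ℝ | ∃ g ∈ 𝒢, r = hammingRisk2 P g})
      ∂(Measure.pi fun _ : Fin m => P)
      = h / d * ∑ w : Fin m → Fin d × (Bool × Bool), (∏ t, sampleWeight d h c (w t)) *
        ∑ i, hammingLoss (A (fun t => φ (w t)) (x i)) (c i) := by
    have hF := (hA_meas P hmem).sub_const (1 - h)
    have hval := integral_pi_map_weightPMF hq hq1 hφm hF
    rw [← hP] at hval
    rw [hinf, hval, Finset.mul_sum]
    refine Finset.sum_congr rfl fun w _ => ?_
    rw [hrisk _ (h𝒢meas _ (hA _))]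
    ring
  rw [hint]
  have hmin : min (((d : ℝ) - 1) / (γ * m)) √(((d : ℝ) - 1) / m) ≤ 2 * h := by
    refine (min_le_right _ _).trans ?_
    rw [hh, mul_div_cancel₀ _ two_ne_zero]
    exact Real.sqrt_le_sqrt (by gcongr; linarith)
  have hlow : h / 4 ≤ h / d * ∑ w : Fin m → Fin d × (Bool × Bool),
      (∏ t, sampleWeight d h c (w t)) *
        ∑ i, hammingLoss (A (fun t => φ (w t)) (x i)) (c i) :=
    calc h / 4 = h / d * (d / 4) := by field_simp
      _ ≤ _ := mul_le_mul_of_nonneg_left hc (by positivity)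
  linarith
end
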